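/- Let T be a tree on n vertices with diameter D ≥ 5 and let P = v₀v₁…v_D be a diametric path in T such that M(v₂)/deg(v₁) ≤ M(v_{D−2})/deg(v_{D−1}). Let w₁,…,w_k be all pendant (degree 1) neighbors of v₁. Then the tree T′ obtained from T by deleting the edges v₁w₁,…,v₁w_k and adding the edges v_{D−1}w₁,…,v_{D−1}w_k satisfies ξ^ac(T) < ξ^ac(T′). -/

import Mathlib

open Finset SimpleGraph

/-- Degree of a vertex `u`: the number of neighbors of `u`. -/
noncomputable def deg {V : Type*} [Fintype V] (G : SimpleGraph V) (u : V) : ℕ :=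
  {v | G.Adj u v}.ncard

/-- `M(u)`: the product of degrees of all neighbors of `u`. -/
noncomputable def Mprod {V : Type*} [Fintype V] (G : SimpleGraph V) (u : V) : ℕ :=
  ∏ᶠ v ∈ {v | G.Adj u v}, deg G v

/-- Eccentricity of a vertex `u`: the maximum distance from `u` to any vertex. -/
noncomputable def ecc {V : Type*} [Fintype V] (G : SimpleGraph V) (u : V) : ℕ :=
  Finset.univ.sup fun v => G.dist u v

/-- Diameter of a graph: the maximum distance between two vertices. -/
noncomputable def gdiam {V : Type*} [Fintype V] (G : SimpleGraph V) : ℕ :=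
  Finset.univ.sup fun u => ecc G u

/-- The augmented eccentric connectivity index `ξ^{ac}(G) = ∑_u M(u)/ε(u)`. -/
noncomputable def xiAC {V : Type*} [Fintype V] (G : SimpleGraph V) : ℝ :=
  ∑ u : V, (Mprod G u : ℝ) / (ecc G u : ℝ)

namespace SimpleGraph

variable {V : Type*}

/-- In a tree, a vertex `c` has at most one neighbour closer to `t`; all the other neighbours are
one step farther from `t` than `c`. -/
theorem IsTree.dist_eq_dist_add_one_of_adj_of_dist_lt {T : SimpleGraph V} (hT : T.IsTree)
    {c x z t : V} (hx : T.Adj c x) (hz : T.Adj c z) (hxz : x ≠ z)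
    (hlt : T.dist z t < T.dist c t) : T.dist x t = T.dist c t + 1 := by
  classical
  have key : ∀ y, T.Adj c y → T.dist y t ≤ T.dist c t →
      ∃ q : T.Walk c t, q.IsPath ∧ q.snd = y := by
    intro y hy hle
    obtain ⟨r, hr, hrl⟩ := hT.connected.exists_path_of_dist y t
    refine ⟨.cons hy r, (Walk.cons_isPath_iff hy r).2 ⟨hr, fun hc => ?_⟩, by simp⟩
    have h1 := Walk.length_dropUntil_lt_length hc hy.ne
    have h2 := dist_le (r.dropUntil c hc)
    omega
  have h1 : T.dist c t < T.dist x t := by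
    by_contra! h
    obtain ⟨q₁, hq₁, rfl⟩ := key x hx h
    obtain ⟨q₂, hq₂, rfl⟩ := key z hz hlt.le
    exact hxz (congrArg Walk.snd ((hT.existsUnique_path c t).unique hq₁ hq₂))
  have h2 := hT.connected.dist_triangle (u := x) (v := c) (w := t)
  have h3 : T.dist x c = 1 := dist_eq_one_iff_adj.2 hx.symm
  omega

/-- In a tree, of two distinct neighbours of `c`, at least one is farther from `t` than `c`. -/
theorem IsTree.dist_eq_dist_add_one_or_of_adj {T : SimpleGraph V} (hT : T.IsTree)
    {c x z : V} (hx : T.Adj c x) (hz : T.Adj c z) (hxz : x ≠ z) (t : V) :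
    T.dist x t = T.dist c t + 1 ∨ T.dist z t = T.dist c t + 1 := by
  by_cases h : T.dist z t < T.dist c t
  · exact .inl (hT.dist_eq_dist_add_one_of_adj_of_dist_lt hx hz hxz h)
  · right
    have h2 := hT.connected.dist_triangle (u := z) (v := c) (w := t)
    have h3 : T.dist z c = 1 := dist_eq_one_iff_adj.2 hz.symm
    have h4 := hT.dist_ne_of_adj t hz
    rw [dist_comm, dist_comm (u := t)] at h4
    omega

/-- In a tree, the length of a path is the distance of its endpoints. -/
theorem IsTree.length_eq_dist {T : SimpleGraph V} (hT : T.IsTree) {u v : V} {p : T.Walk u v}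
    (hp : p.IsPath) : p.length = T.dist u v := by
  obtain ⟨q, hq, hql⟩ := hT.connected.exists_path_of_dist u v
  rw [(hT.existsUnique_path u v).unique hp hq, hql]

/-- In a tree, the distance from a vertex of a path to the end of the path. -/
theorem IsTree.dist_getVert_end {T : SimpleGraph V} (hT : T.IsTree) {u v : V} {p : T.Walk u v}
    (hp : p.IsPath) (i : ℕ) : T.dist (p.getVert i) v = p.length - i := by
  rw [← hT.length_eq_dist (hp.drop i), Walk.drop_length]

/-- Adjacency after moving a set of pendant neighbours of `a` to `c`. -/
theorem fromEdgeSet_move_adj_iff {ι : Type*} {G : SimpleGraph V} {w : ι → V} {a c : V}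
    (hpendant : ∀ v ∈ Set.range w, ∀ x, G.Adj v x → x = a) (hc : c ∉ Set.range w) {u v : V} :
    (fromEdgeSet ((G.edgeSet \ {e | ∃ j, e = s(a, w j)}) ∪ {e | ∃ j, e = s(c, w j)})).Adj u v ↔
      (G.Adj u v ∧ u ∉ Set.range w ∧ v ∉ Set.range w) ∨ (u = c ∧ v ∈ Set.range w) ∨
        (v = c ∧ u ∈ Set.range w) := by
  have hmem : ∀ z, (∃ j, s(u, v) = s(z, w j)) ↔
      (u = z ∧ v ∈ Set.range w) ∨ (v = z ∧ u ∈ Set.range w) := by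
    intro z
    simp only [Sym2.eq_iff, Set.mem_range, exists_or, exists_and_left, exists_and_right]
    tauto
  have hu := hpendant u
  have hv := hpendant v
  have hsymm := G.adj_comm u v
  have hloop : G.Adj u v → u ≠ v := fun h => h.ne
  rw [fromEdgeSet_adj]
  simp only [Set.mem_union, Set.mem_sdiff, mem_edgeSet, Set.mem_ofPred_eq, hmem]
  generalize Set.range w = W at *
  grind

end SimpleGraph

section Basic

variable {V : Type*} [Fintype V] {G H : SimpleGraph V}

theorem dist_le_ecc (G : SimpleGraph V) (u v : V) : G.dist u v ≤ ecc G u :=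
  Finset.le_sup (f := fun v => G.dist u v) (Finset.mem_univ v)

theorem ecc_le {u : V} {m : ℕ} (h : ∀ v, G.dist u v ≤ m) : ecc G u ≤ m :=
  Finset.sup_le fun v _ => h v

theorem ecc_le_gdiam (G : SimpleGraph V) (u : V) : ecc G u ≤ gdiam G :=
  Finset.le_sup (f := fun u => ecc G u) (Finset.mem_univ u)

theorem dist_le_gdiam (G : SimpleGraph V) (u v : V) : G.dist u v ≤ gdiam G :=
  (dist_le_ecc G u v).trans (ecc_le_gdiam G u)

theorem ecc_pos (hG : G.Connected) [Nontrivial V] (u : V) : 0 < ecc G u := by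
  obtain ⟨v, hv⟩ := exists_ne u
  exact (hG.pos_dist_of_ne hv.symm).trans_le (dist_le_ecc G u v)

theorem deg_pos_of_adj {u v : V} (h : G.Adj u v) : 0 < deg G u :=
  (Set.ncard_pos (Set.toFinite _)).2 ⟨v, h⟩

theorem deg_le_deg {u : V} (h : ∀ v, G.Adj u v → H.Adj u v) : deg G u ≤ deg H u :=
  Set.ncard_le_ncard h (Set.toFinite _)

open Classical in
theorem Mprod_eq_prod (G : SimpleGraph V) (u : V) :
    Mprod G u = ∏ v ∈ Finset.univ.filter (G.Adj u), deg G v := by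
  rw [Mprod, ← finprod_mem_coe_finset]
  simp

theorem Mprod_le_Mprod {u : V} (hadj : ∀ v, G.Adj u v → H.Adj u v)
    (hdeg : ∀ v, G.Adj u v → deg G v ≤ deg H v) : Mprod G u ≤ Mprod H u := by
  classical
  rw [Mprod_eq_prod, Mprod_eq_prod]
  refine (Finset.prod_le_prod' (g := fun v => deg H v) fun v hv => hdeg v (by simpa using hv)).trans
    (Finset.prod_le_prod_of_subset_of_one_le' (fun v hv => ?_) fun v hv _ => ?_)
  · simpa using hadj v (by simpa using hv)
  · exact deg_pos_of_adj (G := H) (v := u) (by simpa using hv : H.Adj u v).symm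

open Classical in
/-- The product of the degrees of the neighbours of `u` other than `v`. -/
noncomputable def MprodErase (G : SimpleGraph V) (u v : V) : ℕ :=
  ∏ x ∈ (Finset.univ.filter (G.Adj u)).erase v, deg G x

theorem deg_mul_MprodErase {u v : V} (h : G.Adj u v) :
    deg G v * MprodErase G u v = Mprod G u := by
  classical
  rw [Mprod_eq_prod, MprodErase]
  exact Finset.mul_prod_erase (Finset.univ.filter (G.Adj u)) (fun x => deg G x)
    ((Finset.mem_filter_univ v).2 h)

theorem MprodErase_le_MprodErase {u v : V} (hadj : ∀ x, G.Adj u x → H.Adj u x)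
    (hdeg : ∀ x, x ≠ v → G.Adj u x → deg G x ≤ deg H x) :
    MprodErase G u v ≤ MprodErase H u v := by
  classical
  rw [MprodErase, MprodErase]
  refine (Finset.prod_le_prod' (g := fun v => deg H v) fun x hx => ?_).trans
    (Finset.prod_le_prod_of_subset_of_one_le' (fun x hx => ?_) fun x hx _ => ?_)
  · simp only [Finset.mem_erase, Finset.mem_filter_univ] at hx
    exact hdeg x hx.1 hx.2
  · simp only [Finset.mem_erase, Finset.mem_filter_univ] at hx ⊢
    exact ⟨hx.1, hadj x hx.2⟩
  · simp only [Finset.mem_erase, Finset.mem_filter_univ] at hx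
    exact deg_pos_of_adj hx.2.symm

end Basic

/-- `H` arises from `G` by moving the set `W` of pendant neighbours of `a` to `c`, and `b` is the
only neighbour of `a` outside `W`. -/
structure IsPendantMove {V : Type*} (G H : SimpleGraph V) (a b c : V) (W : Set V) : Prop where
  adj_iff : ∀ u v, H.Adj u v ↔
    (G.Adj u v ∧ u ∉ W ∧ v ∉ W) ∨ (u = c ∧ v ∈ W) ∨ (v = c ∧ u ∈ W)
  adj_iff_of_mem : ∀ u ∈ W, ∀ v, G.Adj u v ↔ v = a
  adj_left_iff : ∀ u, G.Adj a u ↔ u = b ∨ u ∈ W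
  left_notMem : a ∉ W
  inner_notMem : b ∉ W
  target_notMem : c ∉ W
  left_ne_target : a ≠ c

namespace IsPendantMove

variable {V : Type*} {G H : SimpleGraph V} {a b c : V} {W : Set V}

theorem adj_of_notMem (h : IsPendantMove G H a b c W) {u v : V} (hu : u ∉ W) (hv : v ∉ W)
    (huv : G.Adj u v) : H.Adj u v :=
  (h.adj_iff u v).2 (.inl ⟨huv, hu, hv⟩)

theorem adj_of_adj (h : IsPendantMove G H a b c W) {u : V} (hu : u ∉ W) (hua : u ≠ a) (v : V)
    (huv : G.Adj u v) : H.Adj u v :=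
  h.adj_of_notMem hu (fun hv => hua ((h.adj_iff_of_mem v hv u).1 huv.symm)) huv

theorem adj_target (h : IsPendantMove G H a b c W) {v : V} (hv : v ∈ W) : H.Adj c v :=
  (h.adj_iff c v).2 (.inr (.inl ⟨rfl, hv⟩))

theorem exists_hom (h : IsPendantMove G H a b c W) :
    ∃ f : G →g H, ∀ u ∉ W, f u = u := by
  classical
  have hab : H.Adj a b :=
    h.adj_of_notMem h.left_notMem h.inner_notMem ((h.adj_left_iff b).2 (.inl rfl))
  refine ⟨⟨fun u => if u ∈ W then b else u, ?_⟩, fun u hu => if_neg hu⟩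
  intro u v huv
  by_cases hu : u ∈ W
  · obtain rfl := (h.adj_iff_of_mem u hu v).1 huv
    simpa [hu, h.left_notMem] using hab.symm
  · by_cases hv : v ∈ W
    · obtain rfl := (h.adj_iff_of_mem v hv u).1 huv.symm
      simpa [hv, h.left_notMem] using hab
    · simpa [hu, hv] using h.adj_of_notMem hu hv huv

theorem dist_le_of_notMem (h : IsPendantMove G H a b c W) (hG : G.Connected) {u v : V}
    (hu : u ∉ W) (hv : v ∉ W) : H.dist u v ≤ G.dist u v := by
  obtain ⟨f, hf⟩ := h.exists_hom
  obtain ⟨p, hp⟩ := hG.exists_walk_length_eq_dist u v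
  have := dist_le (p.map f)
  rwa [Walk.length_map, hp, hf u hu, hf v hv] at this

theorem connected (h : IsPendantMove G H a b c W) (hG : G.Connected) : H.Connected := by
  obtain ⟨f, hf⟩ := h.exists_hom
  have key : ∀ u, H.Reachable c u := by
    intro u
    by_cases hu : u ∈ W
    · exact (h.adj_target hu).reachable
    · have := (hG.preconnected c u).map f
      rwa [hf u hu, hf c h.target_notMem] at this
  have : Nonempty V := ⟨c⟩
  exact ⟨fun u v => (key u).symm.trans (key v)⟩

theorem dist_le_of_mem (h : IsPendantMove G H a b c W) (hG : G.Connected) {u v : V}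
    (hu : u ∉ W) (hv : v ∈ W) : H.dist v u ≤ G.dist c u + 1 := by
  have h1 := (h.connected hG).dist_triangle (u := v) (v := c) (w := u)
  have h2 : H.dist v c = 1 := dist_eq_one_iff_adj.2 (h.adj_target hv).symm
  have h3 := h.dist_le_of_notMem hG h.target_notMem hu
  omega

variable [Fintype V]

theorem ecc_le (h : IsPendantMove G H a b c W) (hG : G.IsTree) {x y : V} (hx : G.Adj c x)
    (hy : G.Adj c y) (hxy : x ≠ y) (hW : ∀ v ∈ W, ecc G v = gdiam G) (hd : 2 ≤ gdiam G) (u : V) :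
    ecc H u ≤ ecc G u := by
  have key : ∀ t, G.dist c t + 1 ≤ ecc G t := by
    intro t
    rcases hG.dist_eq_dist_add_one_or_of_adj hx hy hxy t with h1 | h1 <;>
      rw [← h1, dist_comm] <;> exact dist_le_ecc G _ _
  refine _root_.ecc_le fun v => ?_
  by_cases hu : u ∈ W <;> by_cases hv : v ∈ W
  · have h1 := (h.connected hG.connected).dist_triangle (u := u) (v := c) (w := v)
    have h2 : H.dist u c = 1 := dist_eq_one_iff_adj.2 (h.adj_target hu).symm
    have h3 : H.dist c v = 1 := dist_eq_one_iff_adj.2 (h.adj_target hv)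
    have := hW u hu
    omega
  · have h1 := h.dist_le_of_mem hG.connected hv hu
    have h2 := key v
    have h3 := ecc_le_gdiam G v
    have := hW u hu
    omega
  · have h1 := h.dist_le_of_mem hG.connected hu hv
    rw [dist_comm]
    exact h1.trans (key u)
  · exact (h.dist_le_of_notMem hG.connected hu hv).trans (dist_le_ecc G u v)

theorem deg_left (h : IsPendantMove G H a b c W) : deg G a = W.ncard + 1 := by
  rw [deg, ← Set.ncard_insert_of_notMem h.inner_notMem (Set.toFinite W)]
  congr 1
  ext u
  simpa using h.adj_left_iff u

theorem deg_eq_one (h : IsPendantMove G H a b c W) {v : V} (hv : v ∈ W) : deg G v = 1 := by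
  rw [deg, Set.ncard_eq_one]
  exact ⟨a, by ext u; simpa using h.adj_iff_of_mem v hv u⟩

theorem deg_target (h : IsPendantMove G H a b c W) : deg G c + W.ncard = deg H c := by
  rw [deg, deg, ← Set.ncard_union_eq _ (Set.toFinite _) (Set.toFinite _)]
  · congr 1
    ext u
    simp only [Set.mem_union, Set.mem_ofPred_eq, h.adj_iff, h.target_notMem]
    have := h.adj_iff_of_mem u
    have := h.left_ne_target
    have := G.adj_comm c u
    grind
  · rw [Set.disjoint_left]
    intro u hu huW
    exact h.left_ne_target ((h.adj_iff_of_mem u huW c).1 (G.adj_symm hu)).symm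

theorem deg_le (h : IsPendantMove G H a b c W) {v : V} (hva : v ≠ a) : deg G v ≤ deg H v := by
  by_cases hv : v ∈ W
  · rw [h.deg_eq_one hv]
    exact deg_pos_of_adj (h.adj_target hv).symm
  · exact deg_le_deg (h.adj_of_adj hv hva)

theorem Mprod_of_mem (h : IsPendantMove G H a b c W) {v : V} (hv : v ∈ W) :
    Mprod G v = deg G a := by
  classical
  rw [Mprod_eq_prod, Finset.prod_eq_single a]
  · intro u hu hua
    exact absurd ((h.adj_iff_of_mem v hv u).1 (by simpa using hu)) hua
  · intro ha
    exact absurd ((h.adj_iff_of_mem v hv a).2 rfl) (by simpa using ha)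

theorem Mprod_move_of_mem (h : IsPendantMove G H a b c W) {v : V} (hv : v ∈ W) :
    Mprod H v = deg H c := by
  classical
  rw [Mprod_eq_prod, Finset.prod_eq_single c]
  · intro u hu huc
    have h1 := (h.adj_iff v u).1 (by simpa using hu)
    have := h.target_notMem
    grind
  · intro hc
    exact absurd (h.adj_target hv).symm (by simpa using hc)

theorem Mprod_left_le (h : IsPendantMove G H a b c W) : Mprod G a ≤ Mprod H a := by
  classical
  have hab : G.Adj a b := (h.adj_left_iff b).2 (.inl rfl)
  have hG : Mprod G a = deg G b := by
    rw [Mprod_eq_prod, Finset.prod_eq_single b]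
    · intro u hu hub
      refine h.deg_eq_one (((h.adj_left_iff u).1 ?_).resolve_left hub)
      simpa using hu
    · intro hb
      exact absurd hab (by simpa using hb)
  have hH : H.Adj a b := h.adj_of_notMem h.left_notMem h.inner_notMem hab
  rw [hG, Mprod_eq_prod]
  refine (h.deg_le hab.ne').trans
    (Finset.single_le_prod' (f := fun v => deg H v) (fun v hv => ?_) (by simpa using hH))
  exact deg_pos_of_adj (G := H) (v := a) (by simpa using hv : H.Adj a v).symm

theorem Mprod_le (h : IsPendantMove G H a b c W) (hc : 2 ≤ deg G c) {u : V} (hub : u ≠ b) :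
    Mprod G u ≤ Mprod H u := by
  by_cases hu : u ∈ W
  · rw [h.Mprod_of_mem hu, h.Mprod_move_of_mem hu, h.deg_left, ← h.deg_target]
    omega
  by_cases hua : u = a
  · rw [hua]; exact h.Mprod_left_le
  refine Mprod_le_Mprod (h.adj_of_adj hu hua) fun v huv => h.deg_le ?_
  rintro rfl
  exact ((h.adj_left_iff u).1 huv.symm).elim hub hu

theorem xiAC_lt (h : IsPendantMove G H a b c W) (hG : G.IsTree) {d x : V} (hd : G.Adj c d)
    (hx : G.Adj c x) (hdx : d ≠ x) (hW : ∀ v ∈ W, ecc G v = gdiam G) (hdiam : 2 ≤ gdiam G)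
    (hne : W.Nonempty) (hbd : b ≠ d) (had : ¬ G.Adj a d) (hda : d ≠ a)
    (hecc : ecc G d ≤ ecc G b)
    (hratio : (Mprod G b : ℝ) / deg G a ≤ (Mprod G d : ℝ) / deg G c) :
    xiAC G < xiAC H := by
  classical
  have hab : G.Adj a b := (h.adj_left_iff b).2 (.inl rfl)
  have : Nontrivial V := ⟨⟨a, b, hab.ne⟩⟩
  have hc : 2 ≤ deg G c := by
    rw [deg, ← Set.ncard_pair hdx]
    refine Set.ncard_le_ncard ?_ (Set.toFinite _)
    rintro y (rfl | rfl)
    exacts [hd, hx]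
  have heccH : ∀ u, ecc H u ≤ ecc G u := h.ecc_le hG hd hx hdx hW hdiam
  have hposH : ∀ u, 0 < ecc H u := ecc_pos (h.connected hG.connected)
  have hdW : d ∉ W := fun hdW => had ((h.adj_left_iff d).2 (.inr hdW))
  have hba : b ≠ a := hab.ne'
  have hdiv : ∀ u m : ℕ, ∀ v, u ≤ m → (u : ℝ) / ecc G v ≤ (m : ℝ) / ecc H v := fun u m v hum =>
    div_le_div₀ (Nat.cast_nonneg m) (Nat.cast_le.2 hum) (Nat.cast_pos.2 (hposH v))
      (Nat.cast_le.2 (heccH v))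
  have hrest : ∑ u ∈ (Finset.univ.erase b).erase d, (Mprod G u : ℝ) / ecc G u <
      ∑ u ∈ (Finset.univ.erase b).erase d, (Mprod H u : ℝ) / ecc H u := by
    refine Finset.sum_lt_sum (fun u hu => ?_) ?_
    · simp only [Finset.mem_erase] at hu
      exact hdiv _ _ u (h.Mprod_le hc hu.2.1)
    · obtain ⟨v, hv⟩ := hne
      refine ⟨v, ?_, ?_⟩
      · simp only [Finset.mem_erase, Finset.mem_univ, and_true]
        exact ⟨fun e => hdW (e ▸ hv), fun e => h.inner_notMem (e ▸ hv)⟩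
      · refine lt_of_lt_of_le ?_ (hdiv _ (Mprod H v) v le_rfl)
        refine div_lt_div_of_pos_right (Nat.cast_lt.2 ?_)
          (Nat.cast_pos.2 (ecc_pos hG.connected v))
        rw [h.Mprod_of_mem hv, h.Mprod_move_of_mem hv, h.deg_left, ← h.deg_target]
        omega
  set A := MprodErase G b a
  set B := MprodErase G d c
  have hA : deg G a * A = Mprod G b := deg_mul_MprodErase hab.symm
  have hB : deg G c * B = Mprod G d := deg_mul_MprodErase hd.symm
  have hAB : (A : ℝ) ≤ B := by
    have h1 : (0 : ℝ) < deg G a := Nat.cast_pos.2 (deg_pos_of_adj hab)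
    have h2 : (0 : ℝ) < deg G c := Nat.cast_pos.2 (deg_pos_of_adj hd)
    rwa [← hA, ← hB, Nat.cast_mul, Nat.cast_mul, mul_div_cancel_left₀ _ h1.ne',
      mul_div_cancel_left₀ _ h2.ne'] at hratio
  have hHb : A ≤ Mprod H b := by
    have hadj : H.Adj b a :=
      h.adj_of_adj h.inner_notMem hba a hab.symm
    rw [← deg_mul_MprodErase hadj]
    refine le_trans ?_ (Nat.le_mul_of_pos_left _ (deg_pos_of_adj hadj.symm))
    exact MprodErase_le_MprodErase (h.adj_of_adj h.inner_notMem hba) fun v hv _ => h.deg_le hv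
  have hHd : (deg G c + W.ncard) * B ≤ Mprod H d := by
    rw [← deg_mul_MprodErase (h.adj_of_adj hdW hda c hd.symm), ← h.deg_target]
    refine Nat.mul_le_mul_left _ (MprodErase_le_MprodErase (h.adj_of_adj hdW hda)
      fun v _ hdv => h.deg_le ?_)
    rintro rfl
    exact had hdv.symm
  have hpair : (Mprod G b : ℝ) / ecc G b + (Mprod G d : ℝ) / ecc G d ≤
      (Mprod H b : ℝ) / ecc H b + (Mprod H d : ℝ) / ecc H d := by
    have h1 := hdiv _ _ b hHb
    have h2 := hdiv _ _ d hHd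
    have h3 : (W.ncard * A : ℝ) / ecc G b ≤ (W.ncard * B : ℝ) / ecc G d :=
      div_le_div₀ (by positivity) (by gcongr) (Nat.cast_pos.2 (ecc_pos hG.connected d))
        (Nat.cast_le.2 hecc)
    rw [← hA, ← hB, h.deg_left]
    push_cast at h2 ⊢
    rw [add_mul, add_div] at h2 ⊢
    rw [one_mul]
    linarith
  have hsum : ∀ f : V → ℝ, ∑ u, f u = f b + f d + ∑ u ∈ (Finset.univ.erase b).erase d, f u := by
    intro f
    rw [← Finset.add_sum_erase _ f (Finset.mem_univ b),
      ← Finset.add_sum_erase _ f (Finset.mem_erase.2 ⟨hbd.symm, Finset.mem_univ d⟩), add_assoc]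
  rw [xiAC, xiAC, hsum, hsum fun u => (Mprod H u : ℝ) / ecc H u]
  exact add_lt_add_of_le_of_lt hpair hrest

end IsPendantMove

/-- Theorem: Let `T` be a tree with diameter `D ≥ 5` and `P = v₀v₁…v_D` a diametric path
such that `M(v₂)/deg(v₁) ≤ M(v_{D-2})/deg(v_{D-1})`. Let `w₁, …, w_k` be all pendant
neighbors of `v₁`. The tree `T'` obtained by deleting the edges `v₁ wⱼ` and adding the
edges `v_{D-1} wⱼ` satisfies `ξ^{ac}(T) < ξ^{ac}(T')`. -/
theorem xiAC_pendant_move (n : ℕ) {V : Type*} [Fintype V] (T : SimpleGraph V)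
    (hT : T.IsTree) (hn : Fintype.card V = n)
    (D : ℕ) (hD : D = gdiam T) (hD5 : 5 ≤ D)
    (v0 vD : V) (p : T.Walk v0 vD) (hp : p.IsPath) (hlen : p.length = D)
    (hratio : (Mprod T (p.getVert 2) : ℝ) / (deg T (p.getVert 1) : ℝ) ≤
      (Mprod T (p.getVert (D - 2)) : ℝ) / (deg T (p.getVert (D - 1)) : ℝ))
    (k : ℕ) (w : Fin k → V) (hwinj : Function.Injective w)
    (hwall : ∀ x : V, (∃ j, w j = x) ↔ T.Adj (p.getVert 1) x ∧ deg T x = 1)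
    (T' : SimpleGraph V)
    (hT' : T' = fromEdgeSet
      ((T.edgeSet \ {e | ∃ j, e = s(p.getVert 1, w j)}) ∪
        {e | ∃ j, e = s(p.getVert (D - 1), w j)})) :
    xiAC T < xiAC T' := by
  have hdist : ∀ i, T.dist (p.getVert i) vD = D - i := fun i => hlen ▸ hT.dist_getVert_end hp i
  have hadj : ∀ i, i < D → T.Adj (p.getVert i) (p.getVert (i + 1)) := fun i hi =>
    p.adj_getVert_succ (hlen ▸ hi)
  have hne : ∀ i j, i ≤ D → j ≤ D → i ≠ j → p.getVert i ≠ p.getVert j := fun i j hi hj hij e =>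
    hij (hp.getVert_injOn (by simpa [hlen] using hi) (by simpa [hlen] using hj) e)
  have hle : ∀ u v, T.dist u v ≤ D := fun u v => hD ▸ dist_le_gdiam T u v
  obtain ⟨m, rfl⟩ : ∃ m, D = m + 5 := ⟨D - 5, by omega⟩
  simp only [show m + 5 - 2 = m + 3 by omega, show m + 5 - 1 = m + 4 by omega] at *
  have hfar : ∀ x, T.Adj (p.getVert 1) x → x ≠ p.getVert 2 → T.dist x vD = m + 5 := by
    intro x hx hx2
    have h1 := hdist 1
    have h2 := hdist 2
    have := hT.dist_eq_dist_add_one_of_adj_of_dist_lt hx (hadj 1 (by omega)) hx2 (t := vD)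
      (by rw [h1, h2]; omega)
    omega
  have honly : ∀ x, T.Adj (p.getVert 1) x → x ≠ p.getVert 2 → ∀ z, T.Adj x z →
      z = p.getVert 1 := by
    intro x hx hx2 z hz
    by_contra hz1
    have h1 := hdist 1
    have h2 := hfar x hx hx2
    have := hT.dist_eq_dist_add_one_of_adj_of_dist_lt hz hx.symm hz1 (t := vD) (by omega)
    have := hle z vD
    omega
  have hmem : ∀ x, x ∈ Set.range w ↔ T.Adj (p.getVert 1) x ∧ x ≠ p.getVert 2 := by
    intro x
    rw [Set.mem_range, hwall]
    refine and_congr_right fun hx => ⟨?_, fun hx2 => ?_⟩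
    · rintro hdeg rfl
      obtain ⟨y, hy⟩ := Set.ncard_eq_one.1 hdeg
      have h1 : p.getVert 1 ∈ ({y} : Set V) := hy ▸ hx.symm
      have h3 : p.getVert 3 ∈ ({y} : Set V) := hy ▸ hadj 2 (by omega)
      exact hne 1 3 (by omega) (by omega) (by omega) (h1.trans h3.symm)
    · rw [deg, Set.ncard_eq_one]
      refine ⟨p.getVert 1, Set.eq_singleton_iff_unique_mem.2 ⟨hx.symm, honly x hx hx2⟩⟩
  have hc_notMem : p.getVert (m + 4) ∉ Set.range w := by
    rw [hmem]
    rintro ⟨h1, h2⟩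
    have := hfar _ h1 h2
    have := hdist (m + 4)
    omega
  have hmove : IsPendantMove T T' (p.getVert 1) (p.getVert 2) (p.getVert (m + 4))
      (Set.range w) := by
    have hleft : ∀ u ∈ Set.range w, ∀ v, T.Adj u v ↔ v = p.getVert 1 := by
      intro u hu v
      rw [hmem] at hu
      refine ⟨honly u hu.1 hu.2 v, ?_⟩
      rintro rfl
      exact hu.1.symm
    have ha : p.getVert 1 ∉ Set.range w := by
      rw [hmem]
      exact fun h => h.1.ne rfl
    refine ⟨fun u v => ?_, hleft, fun u => ?_, ha, ?_, hc_notMem,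
      hne 1 (m + 4) (by omega) (by omega) (by omega)⟩
    · rw [hT']
      exact fromEdgeSet_move_adj_iff (fun v hv x => (hleft v hv x).1) hc_notMem
    · rw [hmem]
      have := hadj 1 (by omega)
      grind
    · rw [hmem]
      exact fun h => h.2 rfl
  have hecc : ecc T (p.getVert (m + 3)) ≤ m + 3 := by
    refine ecc_le fun t => ?_
    have h34 : T.Adj (p.getVert (m + 3)) (p.getVert (m + 4)) := hadj (m + 3) (by omega)
    have h45 : T.Adj (p.getVert (m + 4)) (p.getVert (m + 5)) := hadj (m + 4) (by omega)
    have h23 : T.Adj (p.getVert (m + 2)) (p.getVert (m + 3)) := hadj (m + 2) (by omega)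
    have h12 : T.Adj (p.getVert (m + 1)) (p.getVert (m + 2)) := hadj (m + 1) (by omega)
    rcases hT.dist_eq_dist_add_one_or_of_adj h34 h23.symm
      (hne (m + 4) (m + 2) (by omega) (by omega) (by omega)) t with h1 | h1
    · have := hT.dist_eq_dist_add_one_of_adj_of_dist_lt h45 h34.symm
        (hne (m + 5) (m + 3) (by omega) (by omega) (by omega)) (t := t) (by omega)
      have := hle (p.getVert (m + 5)) t
      omega
    · have := hT.dist_eq_dist_add_one_of_adj_of_dist_lt h12.symm h23
        (hne (m + 1) (m + 3) (by omega) (by omega) (by omega)) (t := t) (by omega)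
      have := hle (p.getVert (m + 1)) t
      omega
  have hecc2 : m + 3 ≤ ecc T (p.getVert 2) := by
    have := hdist 2
    have := dist_le_ecc T (p.getVert 2) vD
    omega
  refine hmove.xiAC_lt hT (d := p.getVert (m + 3)) (x := p.getVert (m + 5))
    (hadj (m + 3) (by omega)).symm (hadj (m + 4) (by omega))
    (hne _ _ (by omega) (by omega) (by omega)) (fun v hv => ?_) (by omega)
    ⟨p.getVert 0, (hmem _).2 ⟨(hadj 0 (by omega)).symm, hne _ _ (by omega) (by omega) (by omega)⟩⟩
    (hne _ _ (by omega) (by omega) (by omega)) (fun had => ?_)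
    (hne _ _ (by omega) (by omega) (by omega)) (hecc.trans hecc2) hratio
  · rw [hmem] at hv
    have h1 := hfar v hv.1 hv.2
    have h2 := dist_le_ecc T v vD
    have h3 := ecc_le_gdiam T v
    omega
  · have h1 := hfar _ had (hne _ _ (by omega) (by omega) (by omega))
    have h2 := hdist (m + 3)
    omega
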